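/- arXiv:1010.1077 — 4 statements merged into one kernel-verified Lean document; each statement's English description precedes it below -/
import Mathlib

section
/- Let P ⊆ ℝ³ be the pyramid with base conv{(1,0,0), (0,1,0), (1,1,0), (−1,−1,0)} and apex a = (a₁, a₂, a₃) ∈ ℤ³ with a₃ ≥ 4, i.e., P = conv{(1,0,0), (0,1,0), (1,1,0), (−1,−1,0), a}. Then P is not a maximal lattice-free set: either int(P) ∩ ℤ³ ≠ ∅, or P is properly contained in a convex set K ⊆ ℝ³ with int(K) ∩ ℤ³ = ∅. -/
open Set

/-- The set of integer points `ℤ^d` inside `ℝ^d`. -/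
def intPts (d : ℕ) : Set (Fin d → ℝ) := {x | ∀ i, ∃ z : ℤ, x i = (z : ℝ)}

/-- The lattice `Λ = s·ℤ^d` inside `ℝ^d`. -/
def sLat (d s : ℕ) : Set (Fin d → ℝ) := {x | ∀ i, ∃ z : ℤ, x i = (s : ℝ) * (z : ℝ)}

/-- A polyhedron: a finite intersection of closed halfspaces. -/
def IsPolyhedron {d : ℕ} (P : Set (Fin d → ℝ)) : Prop :=
  ∃ (n : ℕ) (A : Fin n → Fin d → ℝ) (b : Fin n → ℝ),
    P = {x | ∀ i, (∑ j, A i j * x j) ≤ b i}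

/-- An integral set: it equals the convex hull of its integer points. -/
def IsIntegralPoly {d : ℕ} (P : Set (Fin d → ℝ)) : Prop :=
  P = convexHull ℝ (P ∩ intPts d)

/-- The affine map `x ↦ U·x + t` with integer matrix `U` and translation `t : ℝ^d`. -/
noncomputable def affMap {d : ℕ} (U : Matrix (Fin d) (Fin d) ℤ) (t : Fin d → ℝ)
    (x : Fin d → ℝ) : Fin d → ℝ := fun i => (∑ j, (U i j : ℝ) * x j) + t i

/-- The polyhedron cut out by the facet inequalities of the pyramid with apex `a`, where the
right-hand sides of the facets through the edges on `x = 1` and `y = 1` are relaxed by `s` and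
`t`. -/
def relaxedPyramid (a : Fin 3 → ℝ) (s t : ℝ) : Set (Fin 3 → ℝ) :=
  {p | 0 ≤ p 2 ∧ a 2 * p 0 + (1 - a 0) * p 2 - a 2 ≤ s ∧
    a 2 * p 1 + (1 - a 1) * p 2 - a 2 ≤ t ∧
    a 2 * (p 0 - 2 * p 1) + (1 - a 0 + 2 * a 1) * p 2 - a 2 ≤ 0 ∧
    a 2 * (p 1 - 2 * p 0) + (1 + 2 * a 0 - a 1) * p 2 - a 2 ≤ 0}

lemma convex_relaxedPyramid (a : Fin 3 → ℝ) (s t : ℝ) : Convex ℝ (relaxedPyramid a s t) := by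
  rintro p ⟨h1, h2, h3, h4, h5⟩ q ⟨k1, k2, k3, k4, k5⟩ u v hu hv huv
  obtain rfl : v = 1 - u := by linarith
  simp only [relaxedPyramid, mem_ofPred_eq, Pi.add_apply, Pi.smul_apply, smul_eq_mul]
  refine ⟨by positivity, ?_, ?_, ?_, ?_⟩
  · linarith [mul_le_mul_of_nonneg_left h2 hu, mul_le_mul_of_nonneg_left k2 hv]
  · linarith [mul_le_mul_of_nonneg_left h3 hu, mul_le_mul_of_nonneg_left k3 hv]
  · linarith [mul_le_mul_of_nonneg_left h4 hu, mul_le_mul_of_nonneg_left k4 hv]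
  · linarith [mul_le_mul_of_nonneg_left h5 hu, mul_le_mul_of_nonneg_left k5 hv]

lemma convexHull_subset_relaxedPyramid {a : Fin 3 → ℝ} (ha : 0 < a 2) {s t : ℝ}
    (hs : 0 ≤ s) (ht : 0 ≤ t) :
    convexHull ℝ {![1,0,0], ![0,1,0], ![1,1,0], ![-1,-1,0], a} ⊆ relaxedPyramid a s t := by
  refine convexHull_min ?_ (convex_relaxedPyramid a s t)
  rintro p (rfl | rfl | rfl | rfl | rfl) <;> refine ⟨?_, ?_, ?_, ?_, ?_⟩ <;> (try simp) <;> linarith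

lemma exists_add_smul_mem_of_mem_interior {E : Type*} [AddCommGroup E] [Module ℝ E]
    [TopologicalSpace E] [ContinuousAdd E] [ContinuousSMul ℝ E] {K : Set E} {p : E}
    (hp : p ∈ interior K) (v : E) : ∃ ε : ℝ, 0 < ε ∧ p + ε • v ∈ K := by
  have hc : Filter.Tendsto (fun ε : ℝ => p + ε • v) (nhdsWithin 0 (Ioi 0)) (nhds p) := by
    have : Continuous (fun ε : ℝ => p + ε • v) := by fun_prop
    simpa using (this.tendsto 0).mono_left nhdsWithin_le_nhds
  have h := (hc.eventually (mem_interior_iff_mem_nhds.mp hp)).and self_mem_nhdsWithin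
  obtain ⟨ε, h1, h2⟩ := h.exists
  exact ⟨ε, h2, h1⟩

lemma lt_of_mem_interior_relaxedPyramid {a : Fin 3 → ℝ} (ha : 0 < a 2) {s t : ℝ}
    {p : Fin 3 → ℝ} (hp : p ∈ interior (relaxedPyramid a s t)) :
    0 < p 2 ∧ a 2 * p 0 + (1 - a 0) * p 2 - a 2 < s ∧
    a 2 * p 1 + (1 - a 1) * p 2 - a 2 < t ∧
    a 2 * (p 0 - 2 * p 1) + (1 - a 0 + 2 * a 1) * p 2 - a 2 < 0 ∧
    a 2 * (p 1 - 2 * p 0) + (1 + 2 * a 0 - a 1) * p 2 - a 2 < 0 := by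
  obtain ⟨ε, hε, h1, -⟩ := exists_add_smul_mem_of_mem_interior hp ![0, 0, -1]
  obtain ⟨δ, hδ, -, h2, -, h4, -⟩ := exists_add_smul_mem_of_mem_interior hp ![1, 0, 0]
  obtain ⟨η, hη, -, -, h3, -, h5⟩ := exists_add_smul_mem_of_mem_interior hp ![0, 1, 0]
  simp at h1 h2 h3 h4 h5
  have := mul_pos ha hδ
  have := mul_pos ha hη
  refine ⟨?_, ?_, ?_, ?_, ?_⟩ <;> linarith

lemma relaxedPyramid_zero_subset_convexHull {a : Fin 3 → ℝ} (ha : 0 < a 2) :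
    relaxedPyramid a 0 0 ⊆ convexHull ℝ {![1,0,0], ![0,1,0], ![1,1,0], ![-1,-1,0], a} := by
  rintro p ⟨h1, h2, h3, h4, h5⟩
  obtain ⟨τ, hτ⟩ : ∃ τ, p 2 = τ * a 2 := ⟨p 2 / a 2, by field_simp⟩
  rw [hτ] at h1 h2 h3 h4 h5
  have hτ0 : 0 ≤ τ := nonneg_of_mul_nonneg_left h1 ha
  have h2' : p 0 + (1 - a 0) * τ - 1 ≤ 0 := by
    refine nonpos_of_mul_nonpos_right (a := a 2) ?_ ha
    linarith
  have h3' : p 1 + (1 - a 1) * τ - 1 ≤ 0 := by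
    refine nonpos_of_mul_nonpos_right (a := a 2) ?_ ha
    linarith
  have h4' : p 0 - 2 * p 1 + (1 - a 0 + 2 * a 1) * τ - 1 ≤ 0 := by
    refine nonpos_of_mul_nonpos_right (a := a 2) ?_ ha
    linarith
  have h5' : p 1 - 2 * p 0 + (1 + 2 * a 0 - a 1) * τ - 1 ≤ 0 := by
    refine nonpos_of_mul_nonpos_right (a := a 2) ?_ ha
    linarith
  set S : Set (Fin 3 → ℝ) := {![1,0,0], ![0,1,0], ![1,1,0], ![-1,-1,0], a}
  have hS := convex_convexHull ℝ S
  rcases le_total (p 1 - τ * a 1) (p 0 - τ * a 0) with h | h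
  · have key := hS.sum_mem (t := Finset.univ)
      (w := ![τ, (p 0 - τ * a 0) - (p 1 - τ * a 1),
        (1 - τ - (p 0 - τ * a 0) + 2 * (p 1 - τ * a 1)) / 2, (1 - τ - (p 0 - τ * a 0)) / 2])
      (z := ![a, ![1,0,0], ![1,1,0], ![-1,-1,0]])
      (by
        intro i _
        fin_cases i <;> simp <;> linarith)
      (by
        simp [Fin.sum_univ_four]
        ring)
      (by
        intro i _
        refine subset_convexHull ℝ S ?_
        fin_cases i <;> simp [S])
    convert key using 1
    ext i
    fin_cases i <;> simp [Fin.sum_univ_four, hτ] <;> ring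
  · have key := hS.sum_mem (t := Finset.univ)
      (w := ![τ, (p 1 - τ * a 1) - (p 0 - τ * a 0),
        (1 - τ - (p 1 - τ * a 1) + 2 * (p 0 - τ * a 0)) / 2, (1 - τ - (p 1 - τ * a 1)) / 2])
      (z := ![a, ![0,1,0], ![1,1,0], ![-1,-1,0]])
      (by
        intro i _
        fin_cases i <;> simp <;> linarith)
      (by
        simp [Fin.sum_univ_four]
        ring)
      (by
        intro i _
        refine subset_convexHull ℝ S ?_
        fin_cases i <;> simp [S])
    convert key using 1
    ext i
    fin_cases i <;> simp [Fin.sum_univ_four, hτ] <;> ring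

lemma mem_interior_convexHull_of_lt {a : Fin 3 → ℝ} (ha : 0 < a 2) {p : Fin 3 → ℝ}
    (hp : 0 < p 2 ∧ a 2 * p 0 + (1 - a 0) * p 2 - a 2 < 0 ∧
    a 2 * p 1 + (1 - a 1) * p 2 - a 2 < 0 ∧
    a 2 * (p 0 - 2 * p 1) + (1 - a 0 + 2 * a 1) * p 2 - a 2 < 0 ∧
    a 2 * (p 1 - 2 * p 0) + (1 + 2 * a 0 - a 1) * p 2 - a 2 < 0) :
    p ∈ interior (convexHull ℝ {![1,0,0], ![0,1,0], ![1,1,0], ![-1,-1,0], a}) := by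
  refine interior_mono (relaxedPyramid_zero_subset_convexHull ha) ?_
  refine interior_maximal (t := {p : Fin 3 → ℝ | 0 < p 2 ∧
    a 2 * p 0 + (1 - a 0) * p 2 - a 2 < 0 ∧
    a 2 * p 1 + (1 - a 1) * p 2 - a 2 < 0 ∧
    a 2 * (p 0 - 2 * p 1) + (1 - a 0 + 2 * a 1) * p 2 - a 2 < 0 ∧
    a 2 * (p 1 - 2 * p 0) + (1 + 2 * a 0 - a 1) * p 2 - a 2 < 0})
    ?_ ?_ hp
  · rintro q ⟨h1, h2, h3, h4, h5⟩
    exact ⟨h1.le, h2.le, h3.le, h4.le, h5.le⟩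
  · refine IsOpen.and ?_ (IsOpen.and ?_ (IsOpen.and ?_ (IsOpen.and ?_ ?_))) <;>
      exact isOpen_lt (by fun_prop) (by fun_prop)

/-- Residues modulo the height `h` of the first two coordinates of the apex for which the section
at height one need not contain an interior lattice point. -/
def ExceptionalResidues (h r s : ℤ) : Prop :=
  r = 1 ∧ (h = 4 ∧ s = 2 ∨ h = 4 ∧ s = 3 ∨ h = 5 ∧ s = 3 ∨ h = 6 ∧ s = 3)

lemma exists_height_one_or_exceptionalResidues {h r s : ℤ} (hh : 4 ≤ h) (hr : 0 ≤ r)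
    (hrh : r < h) (hs : 0 ≤ s) (hsh : s < h) :
    (∃ X Y : ℤ, h * X + (1 - r) - h < 0 ∧ h * Y + (1 - s) - h < 0 ∧
      h * (X - 2 * Y) + (1 - r + 2 * s) - h < 0 ∧
      h * (Y - 2 * X) + (1 + 2 * r - s) - h < 0) ∨
    ExceptionalResidues h r s ∨ ExceptionalResidues h s r := by
  unfold ExceptionalResidues
  by_cases h00 : 2 * s - r < h - 1 ∧ 2 * r - s < h - 1
  · exact Or.inl ⟨0, 0, by omega, by omega, by omega, by omega⟩
  by_cases h11 : 2 ≤ r ∧ 2 ≤ s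
  · exact Or.inl ⟨1, 1, by omega, by omega, by omega, by omega⟩
  by_cases h01 : 2 ≤ s ∧ 1 + 2 * r < s
  · exact Or.inl ⟨0, 1, by omega, by omega, by omega, by omega⟩
  by_cases h10 : 2 ≤ r ∧ 1 + 2 * s < r
  · exact Or.inl ⟨1, 0, by omega, by omega, by omega, by omega⟩
  right
  rcases (by omega : r = 0 ∨ r = 1 ∨ 2 ≤ r) with rfl | rfl | hr2
  · omega
  · left
    omega
  · obtain rfl : s = 1 := by omega
    right
    omega

lemma ExceptionalResidues.not_exists_lattice_point {h r s : ℤ} (hE : ExceptionalResidues h r s)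
    {X Y z : ℤ} (h0 : 0 < z) (h1 : h * X + (1 - r) * z - h < 0)
    (h2 : h * Y + (1 - s) * z - h < 1)
    (h3 : h * (X - 2 * Y) + (1 - r + 2 * s) * z - h < 0)
    (h4 : h * (Y - 2 * X) + (1 + 2 * r - s) * z - h < 0) : False := by
  obtain ⟨rfl, ⟨rfl, rfl⟩ | ⟨rfl, rfl⟩ | ⟨rfl, rfl⟩ | ⟨rfl, rfl⟩⟩ := hE <;> omega

lemma not_subset_of_lt_relaxation {a : Fin 3 → ℝ} (ha : 1 ≤ a 2) :
    ¬ relaxedPyramid a 1 0 ⊆ relaxedPyramid a 0 0 ∧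
      ¬ relaxedPyramid a 0 1 ⊆ relaxedPyramid a 0 0 := by
  have hne : a 2 * (a 2)⁻¹ = 1 := mul_inv_cancel₀ (by linarith)
  constructor
  · intro hsub
    have hmem : ![1 + (a 2)⁻¹, 1 / 2, 0] ∈ relaxedPyramid a 1 0 := by
      refine ⟨?_, ?_, ?_, ?_, ?_⟩ <;> simp <;> linarith
    obtain ⟨-, h, -⟩ := hsub hmem
    simp at h
    linarith
  · intro hsub
    have hmem : ![1 / 2, 1 + (a 2)⁻¹, 0] ∈ relaxedPyramid a 0 1 := by
      refine ⟨?_, ?_, ?_, ?_, ?_⟩ <;> simp <;> linarith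
    obtain ⟨-, -, h, -⟩ := hsub hmem
    simp at h
    linarith

/-- A pyramid over the base `conv{e₁, e₂, e₁+e₂, -(e₁+e₂)}` with integer apex of height at
least `4` is not maximal lattice-free. -/
theorem arrow_base_pyramid_not_maximal (a : Fin 3 → ℤ) (ha : 4 ≤ a 2)
    (P : Set (Fin 3 → ℝ))
    (hP : P = convexHull ℝ ({![1,0,0], ![0,1,0], ![1,1,0], ![-1,-1,0],
          (fun i => (a i : ℝ))} : Set (Fin 3 → ℝ))) :
    (interior P ∩ intPts 3).Nonempty ∨
    ∃ K : Set (Fin 3 → ℝ), Convex ℝ K ∧ interior K ∩ intPts 3 = ∅ ∧ P ⊆ K ∧ P ≠ K := by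
  set b : Fin 3 → ℝ := fun i => (a i : ℝ) with hb
  have hb4 : (4 : ℝ) ≤ b 2 := by simpa [hb] using (by exact_mod_cast ha : (4 : ℝ) ≤ (a 2 : ℝ))
  have hb0 : 0 < b 2 := by linarith
  subst hP
  obtain ⟨k, r, hk, hr0, hrh⟩ : ∃ k r : ℤ, a 0 = a 2 * k + r ∧ 0 ≤ r ∧ r < a 2 :=
    ⟨a 0 / a 2, a 0 % a 2, (Int.mul_ediv_add_emod _ _).symm, Int.emod_nonneg _ (by omega),
      Int.emod_lt_of_pos _ (by omega)⟩
  obtain ⟨l, s, hl, hs0, hsh⟩ : ∃ k r : ℤ, a 1 = a 2 * k + r ∧ 0 ≤ r ∧ r < a 2 :=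
    ⟨a 1 / a 2, a 1 % a 2, (Int.mul_ediv_add_emod _ _).symm, Int.emod_nonneg _ (by omega),
      Int.emod_lt_of_pos _ (by omega)⟩
  obtain ⟨hn1, hn2⟩ := not_subset_of_lt_relaxation (a := b) (by linarith)
  have hsub0 := convexHull_subset_relaxedPyramid hb0 le_rfl le_rfl
  rcases exists_height_one_or_exceptionalResidues ha hr0 hrh hs0 hsh with
    ⟨X, Y, h1, h2, h3, h4⟩ | hE | hE
  · left
    refine ⟨![((X + k : ℤ) : ℝ), ((Y + l : ℤ) : ℝ), ((1 : ℤ) : ℝ)],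
      mem_interior_convexHull_of_lt hb0 ?_, ?_⟩
    · simp only [hb, Matrix.cons_val]
      norm_cast
      rw [hk, hl]
      refine ⟨by norm_num, ?_, ?_, ?_, ?_⟩ <;> linarith
    · intro i
      fin_cases i
      exacts [⟨_, rfl⟩, ⟨_, rfl⟩, ⟨_, rfl⟩]
  · right
    refine ⟨relaxedPyramid b 0 1, convex_relaxedPyramid _ _ _, ?_,
      convexHull_subset_relaxedPyramid hb0 le_rfl zero_le_one, fun h => hn2 (h ▸ hsub0)⟩
    refine eq_empty_of_forall_notMem ?_
    rintro p ⟨hp, hZ⟩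
    obtain ⟨x, hx⟩ := hZ 0
    obtain ⟨y, hy⟩ := hZ 1
    obtain ⟨z, hz⟩ := hZ 2
    obtain ⟨h0, h1, h2, h3, h4⟩ := lt_of_mem_interior_relaxedPyramid hb0 hp
    simp only [hx, hy, hz, hb] at h0 h1 h2 h3 h4
    norm_cast at h0 h1 h2 h3 h4
    rw [hk] at h1 h3 h4
    rw [hl] at h2 h3 h4
    refine hE.not_exists_lattice_point (X := x - k * z) (Y := y - l * z) h0 ?_ ?_ ?_ ?_ <;>
      linarith
  · right
    refine ⟨relaxedPyramid b 1 0, convex_relaxedPyramid _ _ _, ?_,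
      convexHull_subset_relaxedPyramid hb0 zero_le_one le_rfl, fun h => hn1 (h ▸ hsub0)⟩
    refine eq_empty_of_forall_notMem ?_
    rintro p ⟨hp, hZ⟩
    obtain ⟨x, hx⟩ := hZ 0
    obtain ⟨y, hy⟩ := hZ 1
    obtain ⟨z, hz⟩ := hZ 2
    obtain ⟨h0, h1, h2, h3, h4⟩ := lt_of_mem_interior_relaxedPyramid hb0 hp
    simp only [hx, hy, hz, hb] at h0 h1 h2 h3 h4
    norm_cast at h0 h1 h2 h3 h4
    rw [hk] at h1 h3 h4
    rw [hl] at h2 h3 h4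
    refine hE.not_exists_lattice_point (X := y - l * z) (Y := x - k * z) h0 ?_ ?_ ?_ ?_ <;>
      linarith
end

section
/- Let T ⊆ ℝ² be an integral triangle with lattice width w(T) = 2, exactly i(T) = 2 integer points in its interior, and b(T) ∈ {3, 4, 5, 6} integer points on its boundary. Then there exist a matrix U ∈ ℤ^{2×2} with |det U| = 1 and a vector v ∈ ℤ² such that U·T + v is one of the three triangles conv{(0,0), (0,1), (5,−1)}, conv{(0,0), (0,1), (6,−1)}, conv{(0,1), (4,1), (1,−1)}. -/
open Set

/-- The width of `K ⊆ ℝ²` in direction `u ∈ ℤ²`. -/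
noncomputable def widthAlong (K : Set (Fin 2 → ℝ)) (u : Fin 2 → ℤ) : ℝ :=
  sSup ((fun x => ∑ i, (u i : ℝ) * x i) '' K) - sInf ((fun x => ∑ i, (u i : ℝ) * x i) '' K)

open Topology

section Halfplanes

variable {T : Set (Fin 2 → ℝ)} {p q r x : Fin 2 → ℝ}

theorem convexHull_triple_le {a b c : ℝ} (hp : a * p 0 + b * p 1 ≤ c)
    (hq : a * q 0 + b * q 1 ≤ c) (hr : a * r 0 + b * r 1 ≤ c)
    (hx : x ∈ convexHull ℝ ({p, q, r} : Set (Fin 2 → ℝ))) : a * x 0 + b * x 1 ≤ c := by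
  have hconv : Convex ℝ {y : Fin 2 → ℝ | a * y 0 + b * y 1 ≤ c} := by
    intro y hy z hz s t hs ht hst
    simp only [mem_ofPred_eq, Pi.add_apply, Pi.smul_apply, smul_eq_mul] at *
    have h1 := mul_le_mul_of_nonneg_left hy hs
    have h2 := mul_le_mul_of_nonneg_left hz ht
    have h3 : s * c + t * c = c := by rw [← add_mul, hst, one_mul]
    linarith
  refine convexHull_min ?_ hconv hx
  rintro y (rfl | rfl | rfl) <;> assumption

theorem interior_lt_of_le {a b c : ℝ} (hab : 0 < a ^ 2 + b ^ 2)
    (hT : ∀ y ∈ T, a * y 0 + b * y 1 ≤ c) (hx : x ∈ interior T) : a * x 0 + b * x 1 < c := by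
  have hcont : Continuous fun t : ℝ => x + t • ![a, b] := by fun_prop
  have hev : ∀ᶠ t in 𝓝 (0 : ℝ), x + t • ![a, b] ∈ interior T :=
    hcont.continuousAt.eventually_mem (isOpen_interior.mem_nhds (by simpa using hx))
  obtain ⟨t, ht, ht0⟩ := ((hev.filter_mono nhdsWithin_le_nhds).and
    (self_mem_nhdsWithin : Ioi (0 : ℝ) ∈ 𝓝[>] 0)).exists
  have h := hT _ (interior_subset ht)
  simp only [Pi.add_apply, Pi.smul_apply, smul_eq_mul, Matrix.cons_val_zero,
    Matrix.cons_val_one] at h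
  have := mul_pos (mem_Ioi.1 ht0) hab
  linarith

theorem interior_convexHull_triple_lt {a b c : ℝ} (hab : 0 < a ^ 2 + b ^ 2)
    (hp : a * p 0 + b * p 1 ≤ c) (hq : a * q 0 + b * q 1 ≤ c) (hr : a * r 0 + b * r 1 ≤ c)
    (hx : x ∈ interior (convexHull ℝ ({p, q, r} : Set (Fin 2 → ℝ)))) :
    a * x 0 + b * x 1 < c :=
  interior_lt_of_le hab (fun _ => convexHull_triple_le hp hq hr) hx

theorem mem_convexHull_triple {α β γ : ℝ} (hα : 0 ≤ α) (hβ : 0 ≤ β) (hγ : 0 ≤ γ)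
    (h : α + β + γ = 1) (h0 : x 0 = α * p 0 + β * q 0 + γ * r 0)
    (h1 : x 1 = α * p 1 + β * q 1 + γ * r 1) :
    x ∈ convexHull ℝ ({p, q, r} : Set (Fin 2 → ℝ)) := by
  have hx : x = ∑ i, ![α, β, γ] i • ![p, q, r] i := by
    ext i
    fin_cases i <;> simp [Fin.sum_univ_three, h0, h1]
  rw [hx]
  refine (convex_convexHull ℝ _).sum_mem ?_ ?_ ?_
  · intro i _
    fin_cases i <;> simpa
  · simpa [Fin.sum_univ_three] using h
  · intro i _
    apply subset_convexHull
    fin_cases i <;> simp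

theorem widthAlong_convexHull_triple (u : Fin 2 → ℤ) {a b c : ℝ}
    (ha : (u 0 : ℝ) * p 0 + u 1 * p 1 = a) (hb : (u 0 : ℝ) * q 0 + u 1 * q 1 = b)
    (hc : (u 0 : ℝ) * r 0 + u 1 * r 1 = c) :
    widthAlong (convexHull ℝ ({p, q, r} : Set (Fin 2 → ℝ))) u =
      max a (max b c) - min a (min b c) := by
  have hmem : ∀ y ∈ ({p, q, r} : Set (Fin 2 → ℝ)), (u 0 : ℝ) * y 0 + u 1 * y 1 ∈
      (fun x => ∑ i, (u i : ℝ) * x i) '' convexHull ℝ ({p, q, r} : Set (Fin 2 → ℝ)) :=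
    fun y hy => ⟨y, subset_convexHull ℝ _ hy, by simp [Fin.sum_univ_two]⟩
  have hp := hmem p (by simp)
  have hq := hmem q (by simp)
  have hr := hmem r (by simp)
  rw [ha] at hp
  rw [hb] at hq
  rw [hc] at hr
  have hsup : IsGreatest ((fun x => ∑ i, (u i : ℝ) * x i) ''
      convexHull ℝ ({p, q, r} : Set (Fin 2 → ℝ))) (max a (max b c)) := by
    constructor
    · rcases max_choice a (max b c) with h | h <;> rw [h]
      · exact hp
      · rcases max_choice b c with h | h <;> rw [h] <;> assumption
    · rintro _ ⟨y, hy, rfl⟩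
      simp only [Fin.sum_univ_two]
      exact convexHull_triple_le (by simp [ha]) (by simp [hb]) (by simp [hc]) hy
  have hinf : IsLeast ((fun x => ∑ i, (u i : ℝ) * x i) ''
      convexHull ℝ ({p, q, r} : Set (Fin 2 → ℝ))) (min a (min b c)) := by
    constructor
    · rcases min_choice a (min b c) with h | h <;> rw [h]
      · exact hp
      · rcases min_choice b c with h | h <;> rw [h] <;> assumption
    · rintro _ ⟨y, hy, rfl⟩
      simp only [Fin.sum_univ_two]
      have h1 : min a (min b c) ≤ a := min_le_left _ _
      have h2 : min a (min b c) ≤ b := (min_le_right _ _).trans (min_le_left _ _)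
      have h3 : min a (min b c) ≤ c := (min_le_right _ _).trans (min_le_right _ _)
      have := convexHull_triple_le (a := -u 0) (b := -u 1) (c := -min a (min b c))
        (by linarith) (by linarith) (by linarith) hy
      linarith
  rw [widthAlong, hsup.csSup_eq, hinf.csInf_eq]

end Halfplanes

section Unimodular

/-- A planar unimodular affine map, as a homeomorphism. -/
noncomputable def affHomeo (a b c d : ℤ) (h : (a * d - b * c) * (a * d - b * c) = 1)
    (v : Fin 2 → ℤ) : (Fin 2 → ℝ) ≃ₜ (Fin 2 → ℝ) where
  toFun := affMap !![a, b; c, d] (fun i => (v i : ℝ))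
  invFun x := ![(a * d - b * c) * (d * (x 0 - v 0) - b * (x 1 - v 1)),
    (a * d - b * c) * (a * (x 1 - v 1) - c * (x 0 - v 0))]
  left_inv x := by
    have h' : ((a : ℝ) * d - b * c) * (a * d - b * c) = 1 := by exact_mod_cast h
    ext i
    fin_cases i <;> simp [affMap, Fin.sum_univ_two]
    · linear_combination x 0 * h'
    · linear_combination x 1 * h'
  right_inv x := by
    have h' : ((a : ℝ) * d - b * c) * (a * d - b * c) = 1 := by exact_mod_cast h
    ext i
    fin_cases i <;> simp [affMap, Fin.sum_univ_two]
    · linear_combination (x 0 - v 0) * h'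
    · linear_combination (x 1 - v 1) * h'
  continuous_toFun := by unfold affMap; fun_prop
  continuous_invFun := by
    refine continuous_pi fun i => ?_
    fin_cases i <;> simp <;> fun_prop

variable {a b c d : ℤ} (h : (a * d - b * c) * (a * d - b * c) = 1) (v : Fin 2 → ℤ)

theorem affHomeo_image_intPts : affHomeo a b c d h v '' intPts 2 = intPts 2 := by
  apply Subset.antisymm
  · rintro _ ⟨x, hx, rfl⟩
    choose z hz using hx
    intro i
    refine ⟨∑ j, !![a, b; c, d] i j * z j + v i, ?_⟩
    simp [affHomeo, affMap, hz]
  · intro x hx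
    choose z hz using hx
    refine ⟨(affHomeo a b c d h v).symm x, ?_, (affHomeo a b c d h v).apply_symm_apply x⟩
    intro i
    fin_cases i
    · exact ⟨(a * d - b * c) * (d * (z 0 - v 0) - b * (z 1 - v 1)), by
        simp [affHomeo, hz]⟩
    · exact ⟨(a * d - b * c) * (a * (z 1 - v 1) - c * (z 0 - v 0)), by
        simp [affHomeo, hz]⟩

theorem affHomeo_image_convexHull_triple (p q r : Fin 2 → ℝ) :
    affHomeo a b c d h v '' convexHull ℝ {p, q, r} =
      convexHull ℝ {affHomeo a b c d h v p, affHomeo a b c d h v q, affHomeo a b c d h v r} := by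
  let A : (Fin 2 → ℝ) →ᵃ[ℝ] (Fin 2 → ℝ) :=
    (Matrix.toLin' !![(a : ℝ), b; c, d]).toAffineMap + AffineMap.const ℝ _ fun i => (v i : ℝ)
  have hA : ⇑(affHomeo a b c d h v) = A := by
    ext x i
    fin_cases i <;> simp [affHomeo, affMap, A, Fin.sum_univ_two, Matrix.vecHead, Matrix.vecTail]
  rw [hA, A.image_convexHull, image_insert_eq, image_pair]

theorem affHomeo_apply_intCast (x : Fin 2 → ℤ) : affHomeo a b c d h v (fun i => (x i : ℝ)) =
    ![((a * x 0 + b * x 1 + v 0 : ℤ) : ℝ), ((c * x 0 + d * x 1 + v 1 : ℤ) : ℝ)] := by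
  ext i
  fin_cases i <;> simp [affHomeo, affMap, Fin.sum_univ_two]

theorem ncard_interior_affHomeo_image (T : Set (Fin 2 → ℝ)) :
    (interior (affHomeo a b c d h v '' T) ∩ intPts 2).ncard =
      (interior T ∩ intPts 2).ncard := by
  rw [← Homeomorph.image_interior, ← affHomeo_image_intPts h v,
    ← image_inter (affHomeo a b c d h v).injective, affHomeo_image_intPts,
    ncard_image_of_injective _ (affHomeo a b c d h v).injective]

theorem ncard_frontier_affHomeo_image (T : Set (Fin 2 → ℝ)) :
    (frontier (affHomeo a b c d h v '' T) ∩ intPts 2).ncard =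
      (frontier T ∩ intPts 2).ncard := by
  rw [← Homeomorph.image_frontier, ← affHomeo_image_intPts h v,
    ← image_inter (affHomeo a b c d h v).injective, affHomeo_image_intPts,
    ncard_image_of_injective _ (affHomeo a b c d h v).injective]

theorem abs_det_of_sq_eq_one (h : (a * d - b * c) * (a * d - b * c) = 1) :
    |(!![a, b; c, d] : Matrix (Fin 2) (Fin 2) ℤ).det| = 1 := by
  rw [Matrix.det_fin_two_of]
  rcases mul_self_eq_one_iff.1 h with h | h <;> simp [h]

end Unimodular

/-- `T` is unimodularly equivalent to one of the three triangles of the classification. -/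
def IsClassified (T : Set (Fin 2 → ℝ)) : Prop :=
  ∃ (U : Matrix (Fin 2) (Fin 2) ℤ) (v : Fin 2 → ℤ), |U.det| = 1 ∧
      (affMap U (fun i => (v i : ℝ)) '' T
          = convexHull ℝ ({![0,0], ![0,1], ![5,-1]} : Set (Fin 2 → ℝ)) ∨
       affMap U (fun i => (v i : ℝ)) '' T
          = convexHull ℝ ({![0,0], ![0,1], ![6,-1]} : Set (Fin 2 → ℝ)) ∨
       affMap U (fun i => (v i : ℝ)) '' T
          = convexHull ℝ ({![0,1], ![4,1], ![1,-1]} : Set (Fin 2 → ℝ)))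

section Canonical

theorem ncard_ne_two_of_forall_eq {α : Type*} {S : Set α} {x : α} (h : ∀ y ∈ S, y = x) :
    S.ncard ≠ 2 := by
  have hS : S ⊆ {x} := h
  have := (ncard_le_ncard hS).trans_eq (ncard_singleton x)
  omega

theorem card_le_ncard_of_injective {α : Type*} {S : Set α} {n : ℕ} (hS : S.ncard ≠ 0)
    (f : Fin n → α) (hf : Function.Injective f) (h : ∀ i, f i ∈ S) : n ≤ S.ncard := by
  have h1 := ncard_le_ncard (range_subset_iff.2 h) (finite_of_ncard_ne_zero hS)
  rwa [← image_univ, ncard_image_of_injective _ hf, ncard_univ, Nat.card_fin] at h1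

theorem apex_coordinate_of_interior_ncard {a : ℤ} (ha : 0 ≤ a)
    (hi : (interior (convexHull ℝ ({![0, 0], ![0, 1], ![(a : ℝ), -1]} : Set (Fin 2 → ℝ))) ∩
      intPts 2).ncard = 2) : a = 5 ∨ a = 6 := by
  have ha' : (0 : ℝ) ≤ a := by exact_mod_cast ha
  by_contra! hne
  obtain h | h : a ≤ 4 ∨ 7 ≤ a := by omega
  · refine ncard_ne_two_of_forall_eq (x := ![1, 0]) ?_ hi
    rintro y ⟨hy, hyz⟩
    obtain ⟨m, hm⟩ := hyz 0
    obtain ⟨n, hn⟩ := hyz 1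
    have h1 := interior_convexHull_triple_lt (a := 0) (b := 1) (c := 1) (by norm_num)
      (by simp) (by simp) (by simp) hy
    have h2 := interior_convexHull_triple_lt (a := 0) (b := -1) (c := 1) (by norm_num)
      (by simp) (by simp) (by simp) hy
    have h3 := interior_convexHull_triple_lt (a := -1) (b := 0) (c := 0) (by norm_num)
      (by simp) (by simp) (by simpa using ha') hy
    have h4 := interior_convexHull_triple_lt (a := 2) (b := a) (c := a) (by positivity)
      (by simpa using ha') (by simp) (by simp; linarith) hy
    rw [hm, hn] at h1 h2 h3 h4
    norm_cast at h1 h2 h3 h4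
    obtain rfl : n = 0 := by omega
    obtain rfl : m = 1 := by omega
    ext i
    fin_cases i <;> simp [hm, hn]
  · have h7 : (7 : ℝ) ≤ a := by exact_mod_cast h
    have hmem : ∀ k : Fin 3, ![((k : ℕ) : ℝ) + 1, 0] ∈
        interior (convexHull ℝ ({![0, 0], ![0, 1], ![(a : ℝ), -1]} : Set (Fin 2 → ℝ))) ∩
          intPts 2 := by
      intro k
      constructor
      · have hk : ((k : ℕ) : ℝ) ≤ 2 := by exact_mod_cast Nat.le_of_lt_succ k.2
        have hopen : IsOpen {x : Fin 2 → ℝ | 0 < x 0 ∧ 0 < x 0 + a * x 1 ∧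
            2 * x 0 + a * x 1 < a} :=
          IsOpen.and (isOpen_lt (by fun_prop) (by fun_prop))
            (IsOpen.and (isOpen_lt (by fun_prop) (by fun_prop))
              (isOpen_lt (by fun_prop) (by fun_prop)))
        refine interior_maximal ?_ hopen ⟨?_, ?_, ?_⟩
        · rintro x ⟨h1, h2, h3⟩
          have hpos : (0 : ℝ) < a := by linarith
          refine mem_convexHull_triple (α := (a - (2 * x 0 + a * x 1)) / a)
            (β := (x 0 + a * x 1) / a) (γ := x 0 / a) (div_nonneg (by linarith) hpos.le)
            (div_nonneg h2.le hpos.le) (div_nonneg h1.le hpos.le) ?_ ?_ ?_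
          · field_simp
            ring
          · simp
            field_simp
          · simp
            field_simp
            ring
        all_goals simp
        all_goals first | positivity | linarith
      · intro i
        fin_cases i
        · exact ⟨k + 1, by simp⟩
        · exact ⟨0, by simp⟩
    have := card_le_ncard_of_injective (by omega) _ (fun k l hkl => by
      have := congrFun hkl 0
      simpa [Fin.ext_iff] using this) hmem
    omega

theorem base_length_of_ncard {k c : ℤ} (hk : 0 ≤ k) (hc : c = 0 ∨ c = 1)
    (hi : (interior (convexHull ℝ ({![0, 1], ![(k : ℝ), 1], ![(c : ℝ), -1]} :
      Set (Fin 2 → ℝ))) ∩ intPts 2).ncard = 2)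
    (hb0 : (frontier (convexHull ℝ ({![0, 1], ![(k : ℝ), 1], ![(c : ℝ), -1]} :
      Set (Fin 2 → ℝ))) ∩ intPts 2).ncard ≠ 0)
    (hb : (frontier (convexHull ℝ ({![0, 1], ![(k : ℝ), 1], ![(c : ℝ), -1]} :
      Set (Fin 2 → ℝ))) ∩ intPts 2).ncard ≤ 6) : k = 4 ∧ c = 1 := by
  have hk' : (0 : ℝ) ≤ k := by exact_mod_cast hk
  have h4 : k ≤ 4 := by
    by_contra! hlt
    have h5 : (5 : ℝ) ≤ k := by exact_mod_cast hlt
    have hle : ∀ j : Fin 6, ((j : ℕ) : ℝ) ≤ 5 := fun j => by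
      exact_mod_cast Nat.le_of_lt_succ j.2
    let f : Option (Fin 6) → Fin 2 → ℝ := fun o => o.elim ![(c : ℝ), -1] fun j => ![((j : ℕ) : ℝ), 1]
    have hf : Function.Injective f := by
      rintro (_ | j) (_ | l) h
      · rfl
      · have := congrFun h 1
        norm_num [f] at this
      · have := congrFun h 1
        norm_num [f] at this
      · have := congrFun h 0
        simpa [f, Fin.ext_iff] using this
    have hmem : ∀ o, f o ∈ frontier (convexHull ℝ ({![0, 1], ![(k : ℝ), 1], ![(c : ℝ), -1]} :
        Set (Fin 2 → ℝ))) ∩ intPts 2 := by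
      rintro (_ | j)
      · refine ⟨⟨subset_closure (subset_convexHull ℝ _ (by simp [f])), fun hx => ?_⟩, ?_⟩
        · have := interior_convexHull_triple_lt (a := 0) (b := -1) (c := 1) (by norm_num)
            (by simp) (by simp) (by simp) hx
          norm_num [f] at this
        · intro i
          fin_cases i
          · exact ⟨c, by simp [f]⟩
          · exact ⟨-1, by simp [f]⟩
      · refine ⟨⟨subset_closure ?_, fun hx => ?_⟩, ?_⟩
        · have hpos : (0 : ℝ) < k := by linarith
          have := hle j
          refine mem_convexHull_triple (α := (k - (j : ℕ)) / k) (β := (j : ℕ) / k) (γ := 0)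
            (div_nonneg (by linarith) hpos.le) (by positivity) le_rfl ?_ ?_ ?_
          · field_simp
            ring
          · simp [f]
            field_simp
          · simp [f]
            field_simp
            ring
        · have := interior_convexHull_triple_lt (a := 0) (b := 1) (c := 1) (by norm_num)
            (by simp) (by simp) (by simp) hx
          norm_num [f] at this
        · intro i
          fin_cases i
          · exact ⟨(j : ℕ), by simp [f]⟩
          · exact ⟨1, by simp [f]⟩
    have := card_le_ncard_of_injective (n := 7) hb0 (f ∘ finSuccEquiv 6)
      (hf.comp (finSuccEquiv 6).injective) fun i => hmem _
    omega
  by_contra hne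
  refine ncard_ne_two_of_forall_eq (x := ![1, 0]) ?_ hi
  rintro y ⟨hy, hyz⟩
  obtain ⟨m, hm⟩ := hyz 0
  obtain ⟨n, hn⟩ := hyz 1
  have h1 := interior_convexHull_triple_lt (a := 0) (b := 1) (c := 1) (by norm_num)
    (by simp) (by simp) (by simp) hy
  have h2 := interior_convexHull_triple_lt (a := 0) (b := -1) (c := 1) (by norm_num)
    (by simp) (by simp) (by simp) hy
  have h3 := interior_convexHull_triple_lt (a := -2) (b := -c) (c := -c) (by positivity)
    (by simp) (by simpa using hk') (by simp; linarith) hy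
  have h4 := interior_convexHull_triple_lt (a := 2) (b := c - k) (c := c + k) (by positivity)
    (by simp; linarith) (by simp; linarith) (by simp; linarith) hy
  rw [hm, hn] at h1 h2 h3 h4
  norm_cast at h1 h2 h3 h4
  obtain rfl : n = 0 := by omega
  obtain rfl : m = 1 := by omega
  ext i
  fin_cases i <;> simp [hm, hn]

end Canonical

section Classification

variable {T : Set (Fin 2 → ℝ)} {P Q R u : Fin 2 → ℤ}

theorem exists_sign_mul_nonneg (n : ℤ) : ∃ s : ℤ, s * s = 1 ∧ 0 ≤ s * n := by
  rcases le_total 0 n with h | h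
  · exact ⟨1, by simpa⟩
  · exact ⟨-1, by simpa⟩

theorem isClassified_of_distinct_levels
    (hT : T = convexHull ℝ {fun i => (P i : ℝ), fun i => (Q i : ℝ), fun i => (R i : ℝ)})
    (hi : (interior T ∩ intPts 2).ncard = 2)
    (hQ : u 0 * Q 0 + u 1 * Q 1 = u 0 * P 0 + u 1 * P 1 + 1)
    (hR : u 0 * R 0 + u 1 * R 1 = u 0 * P 0 + u 1 * P 1 - 1) : IsClassified T := by
  obtain ⟨s, hs, hn⟩ := exists_sign_mul_nonneg
    ((Q 0 - P 0) * (R 1 - P 1) - (Q 1 - P 1) * (R 0 - P 0))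
  have hdet : (-s * (Q 1 - P 1) * u 1 - s * (Q 0 - P 0) * u 0) *
      (-s * (Q 1 - P 1) * u 1 - s * (Q 0 - P 0) * u 0) = 1 := by
    have : -s * (Q 1 - P 1) * u 1 - s * (Q 0 - P 0) * u 0 = -s := by
      linear_combination -s * hQ
    rw [this]
    linarith
  let v : Fin 2 → ℤ := ![s * (Q 1 - P 1) * P 0 - s * (Q 0 - P 0) * P 1,
    -(u 0 * P 0 + u 1 * P 1)]
  set a := s * ((Q 0 - P 0) * (R 1 - P 1) - (Q 1 - P 1) * (R 0 - P 0)) with ha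
  have himg : affHomeo _ _ _ _ hdet v '' T =
      convexHull ℝ {![0, 0], ![0, 1], ![(a : ℝ), -1]} := by
    rw [hT, affHomeo_image_convexHull_triple]
    simp only [affHomeo_apply_intCast]
    have h1 : -s * (Q 1 - P 1) * P 0 + s * (Q 0 - P 0) * P 1 + v 0 = 0 := by
      simp [v]
    have h2 : -s * (Q 1 - P 1) * Q 0 + s * (Q 0 - P 0) * Q 1 + v 0 = 0 := by
      simp [v]
      ring
    have h3 : -s * (Q 1 - P 1) * R 0 + s * (Q 0 - P 0) * R 1 + v 0 = a := by
      simp only [v, ha, Matrix.cons_val_zero]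
      ring
    have h4 : u 0 * P 0 + u 1 * P 1 + v 1 = 0 := by simp [v]
    have h5 : u 0 * Q 0 + u 1 * Q 1 + v 1 = 1 := by simp [v]; linarith
    have h6 : u 0 * R 0 + u 1 * R 1 + v 1 = -1 := by simp [v]; linarith
    rw [h1, h2, h3, h4, h5, h6]
    norm_num
  have hcount := ncard_interior_affHomeo_image hdet v T
  rw [himg, hi] at hcount
  rcases apex_coordinate_of_interior_ncard hn hcount with h | h <;> rw [h] at himg
  · exact ⟨_, v, abs_det_of_sq_eq_one hdet, Or.inl (by exact_mod_cast himg)⟩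
  · exact ⟨_, v, abs_det_of_sq_eq_one hdet, Or.inr (Or.inl (by exact_mod_cast himg))⟩

theorem isClassified_of_edge_level (hu : IsCoprime (u 0) (u 1))
    (hT : T = convexHull ℝ {fun i => (Q i : ℝ), fun i => (R i : ℝ), fun i => (P i : ℝ)})
    (hi : (interior T ∩ intPts 2).ncard = 2)
    (hb0 : (frontier T ∩ intPts 2).ncard ≠ 0) (hb : (frontier T ∩ intPts 2).ncard ≤ 6)
    (hQ : u 0 * Q 0 + u 1 * Q 1 = u 0 * P 0 + u 1 * P 1 + 2)
    (hR : u 0 * R 0 + u 1 * R 1 = u 0 * P 0 + u 1 * P 1 + 2) : IsClassified T := by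
  obtain ⟨x, y, hxy⟩ := hu
  obtain ⟨s, hs, hn⟩ := exists_sign_mul_nonneg (y * (R 0 - Q 0) - x * (R 1 - Q 1))
  set m := s * (y * (P 0 - Q 0) - x * (P 1 - Q 1)) / 2 with hm
  set c := s * (y * (P 0 - Q 0) - x * (P 1 - Q 1)) % 2 with hc
  have hmc : 2 * m + c = s * (y * (P 0 - Q 0) - x * (P 1 - Q 1)) := Int.mul_ediv_add_emod _ _
  have hc01 : c = 0 ∨ c = 1 := Int.emod_two_eq_zero_or_one _
  set k := s * (y * (R 0 - Q 0) - x * (R 1 - Q 1)) with hk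
  have hdet : ((s * y + m * u 0) * u 1 - (-s * x + m * u 1) * u 0) *
      ((s * y + m * u 0) * u 1 - (-s * x + m * u 1) * u 0) = 1 := by
    have : (s * y + m * u 0) * u 1 - (-s * x + m * u 1) * u 0 = s := by
      linear_combination s * hxy
    rw [this, hs]
  let v : Fin 2 → ℤ := ![-((s * y + m * u 0) * Q 0 + (-s * x + m * u 1) * Q 1),
    1 - (u 0 * Q 0 + u 1 * Q 1)]
  have himg : affHomeo _ _ _ _ hdet v '' T =
      convexHull ℝ {![0, 1], ![(k : ℝ), 1], ![(c : ℝ), -1]} := by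
    rw [hT, affHomeo_image_convexHull_triple]
    simp only [affHomeo_apply_intCast]
    have h1 : (s * y + m * u 0) * R 0 + (-s * x + m * u 1) * R 1 + v 0 = k := by
      simp only [v, hk, Matrix.cons_val_zero]
      linear_combination m * hR - m * hQ
    have h2 : (s * y + m * u 0) * P 0 + (-s * x + m * u 1) * P 1 + v 0 = c := by
      simp only [v, Matrix.cons_val_zero]
      linear_combination -m * hQ - hmc
    have h3 : (s * y + m * u 0) * Q 0 + (-s * x + m * u 1) * Q 1 + v 0 = 0 := by
      simp [v]
    have h4 : u 0 * Q 0 + u 1 * Q 1 + v 1 = 1 := by simp [v]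
    have h5 : u 0 * R 0 + u 1 * R 1 + v 1 = 1 := by simp [v]; linarith
    have h6 : u 0 * P 0 + u 1 * P 1 + v 1 = -1 := by simp [v]; linarith
    rw [h1, h2, h3, h4, h5, h6]
    norm_num
  have hci := ncard_interior_affHomeo_image hdet v T
  have hcb := ncard_frontier_affHomeo_image hdet v T
  rw [himg] at hci hcb
  obtain ⟨hk4, hc1⟩ := base_length_of_ncard hn hc01 (hci.trans hi) (by rwa [hcb]) (by rwa [hcb])
  rw [hk4, hc1] at himg
  exact ⟨_, v, abs_det_of_sq_eq_one hdet, Or.inr (Or.inr (by exact_mod_cast himg))⟩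

theorem isClassified_of_sorted_levels (hu : IsCoprime (u 0) (u 1))
    (hT : T = convexHull ℝ {fun i => (P i : ℝ), fun i => (Q i : ℝ), fun i => (R i : ℝ)})
    (hi : (interior T ∩ intPts 2).ncard = 2)
    (hb0 : (frontier T ∩ intPts 2).ncard ≠ 0) (hb : (frontier T ∩ intPts 2).ncard ≤ 6)
    (hPQ : u 0 * P 0 + u 1 * P 1 ≤ u 0 * Q 0 + u 1 * Q 1)
    (hQR : u 0 * Q 0 + u 1 * Q 1 ≤ u 0 * R 0 + u 1 * R 1)
    (hPR : u 0 * R 0 + u 1 * R 1 = u 0 * P 0 + u 1 * P 1 + 2) : IsClassified T := by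
  obtain h | h | h : u 0 * Q 0 + u 1 * Q 1 = u 0 * P 0 + u 1 * P 1 ∨
      u 0 * Q 0 + u 1 * Q 1 = u 0 * P 0 + u 1 * P 1 + 1 ∨
      u 0 * Q 0 + u 1 * Q 1 = u 0 * P 0 + u 1 * P 1 + 2 := by omega
  · refine isClassified_of_edge_level (u := -u) (by simpa using hu.neg_neg) hT hi hb0 hb ?_ ?_
    · simp only [Pi.neg_apply]
      linarith
    · simp only [Pi.neg_apply]
      linarith
  · refine isClassified_of_distinct_levels (P := Q) (Q := R) (R := P) (u := u) ?_ hi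
      (by linarith) (by linarith)
    rw [hT, insert_comm, pair_comm]
  · refine isClassified_of_edge_level (Q := Q) (R := R) (P := P) hu ?_ hi hb0 hb h hPR
    rw [hT, insert_comm, pair_comm]

theorem isCoprime_of_widthAlong_eq_two {p q r : Fin 2 → ℝ}
    (hT : T = convexHull ℝ {p, q, r}) (hw : ∀ u : Fin 2 → ℤ, u ≠ 0 → 2 ≤ widthAlong T u)
    (hu0 : u ≠ 0) (hu : widthAlong T u = 2) : IsCoprime (u 0) (u 1) := by
  have hpos : 0 < Int.gcd (u 0) (u 1) := by
    refine Int.gcd_pos_iff.2 ?_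
    by_contra! h
    exact hu0 (by ext i; fin_cases i <;> simp [h])
  obtain ⟨m, n, hmn, hm, hn⟩ := Int.exists_gcd_one hpos
  have hwm := hw ![m, n] fun h => by
    have h0 : m = 0 := congrFun h 0
    have h1 : n = 0 := congrFun h 1
    simp [h0, h1] at hmn
  set g := Int.gcd (u 0) (u 1)
  have hg : (0 : ℝ) < g := by exact_mod_cast hpos
  have hm' : (u 0 : ℝ) = m * g := by exact_mod_cast hm
  have hn' : (u 1 : ℝ) = n * g := by exact_mod_cast hn
  have hscale : widthAlong T u = g * widthAlong T ![m, n] := by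
    rw [hT, widthAlong_convexHull_triple ![m, n] rfl rfl rfl,
      widthAlong_convexHull_triple u (a := g * (m * p 0 + n * p 1))
        (b := g * (m * q 0 + n * q 1)) (c := g * (m * r 0 + n * r 1))
        (by rw [hm', hn']; ring) (by rw [hm', hn']; ring) (by rw [hm', hn']; ring),
      mul_sub, mul_max_of_nonneg _ _ hg.le, mul_max_of_nonneg _ _ hg.le,
      mul_min_of_nonneg _ _ hg.le, mul_min_of_nonneg _ _ hg.le]
    simp
  have hg1 : (g : ℝ) ≤ 1 := by nlinarith
  have hg1' : g ≤ 1 := by exact_mod_cast hg1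
  exact Int.isCoprime_iff_gcd_eq_one.2 (by omega)

end Classification

/-- Every integral triangle in `ℝ²` with lattice width `2`, two interior integer points and
`3`–`6` boundary integer points is, up to a unimodular transformation, one of three
triangles. -/
theorem triangles_width_two_two_interior_points (p q r : Fin 2 → ℝ)
    (hp : p ∈ intPts 2) (hq : q ∈ intPts 2) (hr : r ∈ intPts 2)
    (hind : AffineIndependent ℝ ![p, q, r])
    (T : Set (Fin 2 → ℝ)) (hT : T = convexHull ℝ ({p, q, r} : Set (Fin 2 → ℝ)))
    (hw1 : ∀ u : Fin 2 → ℤ, u ≠ 0 → 2 ≤ widthAlong T u)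
    (hw2 : ∃ u : Fin 2 → ℤ, u ≠ 0 ∧ widthAlong T u = 2)
    (hi : (interior T ∩ intPts 2).ncard = 2)
    (hb : (frontier T ∩ intPts 2).ncard ∈ ({3, 4, 5, 6} : Set ℕ)) :
    ∃ (U : Matrix (Fin 2) (Fin 2) ℤ) (v : Fin 2 → ℤ), |U.det| = 1 ∧
      (affMap U (fun i => (v i : ℝ)) '' T
          = convexHull ℝ ({![0,0], ![0,1], ![5,-1]} : Set (Fin 2 → ℝ)) ∨
       affMap U (fun i => (v i : ℝ)) '' T
          = convexHull ℝ ({![0,0], ![0,1], ![6,-1]} : Set (Fin 2 → ℝ)) ∨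
       affMap U (fun i => (v i : ℝ)) '' T
          = convexHull ℝ ({![0,1], ![4,1], ![1,-1]} : Set (Fin 2 → ℝ))) := by
  choose P hP using hp
  choose Q hQ using hq
  choose R hR using hr
  obtain rfl : p = fun i => (P i : ℝ) := funext hP
  obtain rfl : q = fun i => (Q i : ℝ) := funext hQ
  obtain rfl : r = fun i => (R i : ℝ) := funext hR
  obtain ⟨u, hu0, hu⟩ := hw2
  have hcop := isCoprime_of_widthAlong_eq_two hT hw1 hu0 hu
  have hb' : (frontier T ∩ intPts 2).ncard ≠ 0 ∧ (frontier T ∩ intPts 2).ncard ≤ 6 := by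
    simp only [mem_insert_iff, mem_singleton_iff] at hb
    omega
  obtain ⟨hb0, hb6⟩ := hb'
  rw [hT, widthAlong_convexHull_triple u rfl rfl rfl] at hu
  norm_cast at hu
  change IsClassified T
  rcases le_total (u 0 * P 0 + u 1 * P 1) (u 0 * Q 0 + u 1 * Q 1) with h1 | h1 <;>
  rcases le_total (u 0 * Q 0 + u 1 * Q 1) (u 0 * R 0 + u 1 * R 1) with h2 | h2 <;>
  rcases le_total (u 0 * P 0 + u 1 * P 1) (u 0 * R 0 + u 1 * R 1) with h3 | h3
  · exact isClassified_of_sorted_levels hcop hT hi hb0 hb6 h1 h2 (by omega)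
  · exact isClassified_of_sorted_levels hcop hT hi hb0 hb6 h1 h2 (by omega)
  · exact isClassified_of_sorted_levels hcop (by rw [hT, pair_comm]) hi hb0 hb6 h3 h2 (by omega)
  · exact isClassified_of_sorted_levels hcop (by rw [hT, pair_comm, insert_comm]) hi hb0 hb6 h3 h1
      (by omega)
  · exact isClassified_of_sorted_levels hcop (by rw [hT, insert_comm]) hi hb0 hb6 h1 h3 (by omega)
  · exact isClassified_of_sorted_levels hcop (by rw [hT, insert_comm, pair_comm]) hi hb0 hb6 h2 h3
      (by omega)
  · exact isClassified_of_sorted_levels hcop (by rw [hT, pair_comm, insert_comm, pair_comm])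
      hi hb0 hb6 h2 h1 (by omega)
  · exact isClassified_of_sorted_levels hcop (by rw [hT, pair_comm, insert_comm, pair_comm])
      hi hb0 hb6 h2 h1 (by omega)
end

section
/- Let P ⊆ ℝ³ be the simplex P = conv{(1,0,0), (0,1,0), (−1,−1,0), a} with a = (a₁, a₂, a₃) ∈ ℤ³ and a₃ ≥ 13. Then P is not lattice-free, i.e., int(P) ∩ ℤ³ ≠ ∅. -/
open Set

/-- If `n₁ + n₂ + n₃ ≥ 1`, some integer point satisfies `x + y ≤ n₁`, `y - 2x ≤ n₂` and
`x - 2y ≤ n₃`. -/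
lemma exists_int_point_le_of_one_le_sum {n₁ n₂ n₃ : ℤ} (h : 1 ≤ n₁ + n₂ + n₃) :
    ∃ x y : ℤ, x + y ≤ n₁ ∧ y - 2 * x ≤ n₂ ∧ x - 2 * y ≤ n₃ := by
  obtain ⟨d, hd | hd | hd⟩ : ∃ d, n₁ - n₂ = 3 * d ∨ n₁ - n₂ = 3 * d + 1 ∨ n₁ - n₂ = 3 * d - 1 :=
    ⟨(n₁ - n₂ + 1) / 3, by omega⟩
  · exact ⟨d, n₁ - d, by omega, by omega, by omega⟩
  · exact ⟨d, n₁ - 1 - d, by omega, by omega, by omega⟩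
  · exact ⟨d, n₁ - d, by omega, by omega, by omega⟩

/-- Integer form of the existence of a lattice point in the interior of the simplex with apex
`(a, b, h)`: the point is found at height `1` or `3`. -/
lemma exists_int_point_in_simplex (a b h : ℤ) (hh : 10 ≤ h) :
    ∃ x y k : ℤ, 0 < k ∧ h * (x + y) < h - k * (1 - (a + b)) ∧
      h * (y - 2 * x) < h - k * (1 - (b - 2 * a)) ∧
      h * (x - 2 * y) < h - k * (1 - (a - 2 * b)) := by
  have h0 : 0 < h := by omega
  have division (c : ℤ) : ∃ m g : ℤ, 0 ≤ g ∧ g < h ∧ c = h * m + g :=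
    ⟨c / h, c % h, Int.emod_nonneg _ h0.ne', Int.emod_lt_of_pos _ h0,
      (Int.mul_ediv_add_emod c h).symm⟩
  obtain ⟨m₁, g₁, hg₁, hg₁', e₁⟩ := division (1 - (a + b))
  obtain ⟨m₂, g₂, hg₂, hg₂', e₂⟩ := division (1 - (b - 2 * a))
  obtain ⟨m₃, g₃, hg₃, hg₃', e₃⟩ := division (1 - (a - 2 * b))
  have hsum : h * (m₁ + m₂ + m₃) + (g₁ + g₂ + g₃) = 3 := by linear_combination -e₁ - e₂ - e₃
  rw [e₁, e₂, e₃]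
  have hm : m₁ + m₂ + m₃ ≤ 0 := by
    by_contra! hm
    nlinarith [mul_le_mul_of_nonneg_left (show 1 ≤ m₁ + m₂ + m₃ by omega) h0.le]
  rcases hm.eq_or_lt with hm | hm
  · have hg : g₁ + g₂ + g₃ = 3 := by simpa [hm] using hsum
    obtain rfl : m₃ = -m₁ - m₂ := by omega
    exact ⟨m₂ - m₁, -2 * m₁ - m₂, 3, by norm_num, by linarith, by linarith, by linarith⟩
  · obtain ⟨x, y, h₁, h₂, h₃⟩ := exists_int_point_le_of_one_le_sum
      (show 1 ≤ -m₁ + -m₂ + -m₃ by omega)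
    have h₁' := mul_le_mul_of_nonneg_left h₁ h0.le
    have h₂' := mul_le_mul_of_nonneg_left h₂ h0.le
    have h₃' := mul_le_mul_of_nonneg_left h₃ h0.le
    exact ⟨x, y, 1, by norm_num, by linarith, by linarith, by linarith⟩

/-- The strict facet inequalities of the simplex with apex `a` describe interior points. -/
lemma mem_interior_convexHull_simplex {a p : Fin 3 → ℝ} (h0 : 0 < a 2) (hp : 0 < p 2)
    (h₁ : a 2 * (p 0 + p 1) < a 2 - p 2 * (1 - (a 0 + a 1)))
    (h₂ : a 2 * (p 1 - 2 * p 0) < a 2 - p 2 * (1 - (a 1 - 2 * a 0)))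
    (h₃ : a 2 * (p 0 - 2 * p 1) < a 2 - p 2 * (1 - (a 0 - 2 * a 1))) :
    p ∈ interior (convexHull ℝ ({![1,0,0], ![0,1,0], ![-1,-1,0], a} : Set (Fin 3 → ℝ))) := by
  refine mem_interior.2 ⟨{q | 0 < q 2 ∧
    a 2 * (q 0 + q 1) < a 2 - q 2 * (1 - (a 0 + a 1)) ∧
    a 2 * (q 1 - 2 * q 0) < a 2 - q 2 * (1 - (a 1 - 2 * a 0)) ∧
    a 2 * (q 0 - 2 * q 1) < a 2 - q 2 * (1 - (a 0 - 2 * a 1))}, ?_, ?_, hp, h₁, h₂, h₃⟩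
  · rintro q ⟨hq, k₁, k₂, k₃⟩
    set w : Fin 4 → ℝ :=
      ![(a 2 - q 2 * (1 - (a 1 - 2 * a 0)) - a 2 * (q 1 - 2 * q 0)) / (3 * a 2),
        (a 2 - q 2 * (1 - (a 0 - 2 * a 1)) - a 2 * (q 0 - 2 * q 1)) / (3 * a 2),
        (a 2 - q 2 * (1 - (a 0 + a 1)) - a 2 * (q 0 + q 1)) / (3 * a 2),
        q 2 / a 2] with hw
    set v : Fin 4 → Fin 3 → ℝ := ![![1,0,0], ![0,1,0], ![-1,-1,0], a] with hv
    have hw0 : ∀ i ∈ Finset.univ, 0 ≤ w i := by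
      intro i _
      fin_cases i
      · exact div_nonneg (sub_nonneg.2 k₂.le) (by positivity)
      · exact div_nonneg (sub_nonneg.2 k₃.le) (by positivity)
      · exact div_nonneg (sub_nonneg.2 k₁.le) (by positivity)
      · exact div_nonneg hq.le h0.le
    have hw1 : ∑ i, w i = 1 := by
      simp only [hw, Fin.sum_univ_four, Matrix.cons_val]
      field_simp
      ring
    have hv_mem : ∀ i ∈ Finset.univ, v i ∈ convexHull ℝ
        ({![1,0,0], ![0,1,0], ![-1,-1,0], a} : Set (Fin 3 → ℝ)) := by
      intro i _
      apply subset_convexHull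
      fin_cases i <;> simp [hv]
    have hq_eq : q = ∑ i, w i • v i := by
      ext j
      simp only [hw, hv, Fin.sum_univ_four, Matrix.cons_val, Pi.add_apply, Pi.smul_apply,
        smul_eq_mul]
      fin_cases j <;> simp <;> field_simp <;> ring
    rw [hq_eq]
    exact (convex_convexHull ℝ _).sum_mem hw0 hw1 hv_mem
  · refine IsOpen.and ?_ (IsOpen.and ?_ (IsOpen.and ?_ ?_)) <;>
      refine isOpen_lt ?_ ?_ <;> fun_prop

/-- A simplex over the base `conv{e₁, e₂, -(e₁+e₂)}` with integer apex of height at least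
`13` is not lattice-free. -/
theorem simplex_kite_base_not_latticefree (a : Fin 3 → ℤ) (ha : 13 ≤ a 2)
    (P : Set (Fin 3 → ℝ))
    (hP : P = convexHull ℝ ({![1,0,0], ![0,1,0], ![-1,-1,0],
          (fun i => (a i : ℝ))} : Set (Fin 3 → ℝ))) :
    (interior P ∩ intPts 3).Nonempty := by
  subst hP
  obtain ⟨x, y, k, hk, h₁, h₂, h₃⟩ :=
    exists_int_point_in_simplex (a 0) (a 1) (a 2) (by omega)
  refine ⟨fun i => ((![x, y, k] i : ℤ) : ℝ), ?_, fun i => ⟨_, rfl⟩⟩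
  refine mem_interior_convexHull_simplex ?_ ?_ ?_ ?_ ?_
  · exact_mod_cast (by omega : 0 < a 2)
  · simpa using hk
  · simp only [Matrix.cons_val]
    exact_mod_cast h₁
  · simp only [Matrix.cons_val]
    exact_mod_cast h₂
  · simp only [Matrix.cons_val]
    exact_mod_cast h₃
end

section
/- Let P ⊆ ℝ³ be the simplex P = conv{(1,0,0), (−1,0,0), (0,2,0), a} with a = (a₁, a₂, a₃) ∈ ℤ³ and a₃ ≥ 9. Then P is not lattice-free, i.e., int(P) ∩ ℤ³ ≠ ∅. -/
open Set

/-- Rounding `a₁ / h` and `a₂ / h` gives a lattice point at height `1` or `2` strictly inside the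
simplex with base `conv{±e₁, 2e₂}` and apex `(a₁, a₂, h)`. -/
lemma exists_int_point_height_one_or_two (a₁ a₂ h : ℤ) (hh : 9 ≤ h) :
    ∃ k x y : ℤ, 0 < k ∧ 0 < h * y - k * a₂ ∧
      2 * (h * x - k * a₁) + (h * y - k * a₂) < 2 * (h - k) ∧
      -(2 * (h * x - k * a₁)) + (h * y - k * a₂) < 2 * (h - k) := by
  obtain ⟨x, hx₁, hx₂⟩ : ∃ x : ℤ, -h ≤ 2 * (h * x - a₁) ∧ 2 * (h * x - a₁) ≤ h := by
    refine ⟨(2 * a₁ + h) / (2 * h), ?_, ?_⟩ <;>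
      linarith [Int.emod_nonneg (2 * a₁ + h) (show 2 * h ≠ 0 by lia),
        Int.emod_lt_of_pos (2 * a₁ + h) (show 0 < 2 * h by lia),
        Int.mul_ediv_add_emod (2 * a₁ + h) (2 * h)]
  obtain ⟨y, hy₁, hy₂⟩ : ∃ y : ℤ, 0 < h * y - a₂ ∧ h * y - a₂ ≤ h := by
    refine ⟨a₂ / h + 1, ?_, ?_⟩ <;>
      linarith [Int.emod_nonneg a₂ (show h ≠ 0 by lia),
        Int.emod_lt_of_pos a₂ (show 0 < h by lia), Int.mul_ediv_add_emod a₂ h]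
  by_cases h₁ : 2 * |h * x - a₁| + (h * y - a₂) < 2 * (h - 1)
  · refine ⟨1, x, y, one_pos, ?_, ?_, ?_⟩ <;>
      linarith [le_abs_self (h * x - a₁), neg_abs_le (h * x - a₁)]
  · rcases abs_cases (h * x - a₁) with ⟨hu, -⟩ | ⟨hu, -⟩ <;> rw [hu] at h₁
    · refine ⟨2, 2 * x - 1, 2 * y - 1, two_pos, ?_, ?_, ?_⟩ <;> ring_nf at * <;> lia
    · refine ⟨2, 2 * x + 1, 2 * y - 1, two_pos, ?_, ?_, ?_⟩ <;> ring_nf at * <;> lia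

/-- Strict facet inequalities place a point in the interior of the simplex with base
`conv{±e₁, 2e₂}` and apex `b`. -/
lemma mem_interior_convexHull_of_facet_ineqs (b p : Fin 3 → ℝ) (hb : 0 < b 2) (h₀ : 0 < p 2)
    (h₁ : 0 < b 2 * p 1 - p 2 * b 1)
    (h₂ : 2 * (b 2 * p 0 - p 2 * b 0) + (b 2 * p 1 - p 2 * b 1) < 2 * (b 2 - p 2))
    (h₃ : -(2 * (b 2 * p 0 - p 2 * b 0)) + (b 2 * p 1 - p 2 * b 1) < 2 * (b 2 - p 2)) :
    p ∈ interior (convexHull ℝ ({![1,0,0], ![-1,0,0], ![0,2,0], b} : Set (Fin 3 → ℝ))) := by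
  let U : Set (Fin 3 → ℝ) := {q | 0 < q 2 ∧ 0 < b 2 * q 1 - q 2 * b 1 ∧
    2 * (b 2 * q 0 - q 2 * b 0) + (b 2 * q 1 - q 2 * b 1) < 2 * (b 2 - q 2) ∧
    -(2 * (b 2 * q 0 - q 2 * b 0)) + (b 2 * q 1 - q 2 * b 1) < 2 * (b 2 - q 2)}
  have hU : IsOpen U := by
    simp only [U, Set.ofPred_and]
    exact (isOpen_lt (by fun_prop) (by fun_prop)).inter
      ((isOpen_lt (by fun_prop) (by fun_prop)).inter
        ((isOpen_lt (by fun_prop) (by fun_prop)).inter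
          (isOpen_lt (by fun_prop) (by fun_prop))))
  refine interior_maximal ?_ hU ⟨h₀, h₁, h₂, h₃⟩
  rintro q ⟨q₀, q₁, q₂, q₃⟩
  let D : ℝ := 4 * b 2
  have hD : 0 < D := by positivity
  let w : Fin 4 → ℝ :=
    ![(2 * (b 2 - q 2) - (b 2 * q 1 - q 2 * b 1) + 2 * (b 2 * q 0 - q 2 * b 0)) / D,
      (2 * (b 2 - q 2) - (b 2 * q 1 - q 2 * b 1) - 2 * (b 2 * q 0 - q 2 * b 0)) / D,
      2 * (b 2 * q 1 - q 2 * b 1) / D, 4 * q 2 / D]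
  let z : Fin 4 → Fin 3 → ℝ := ![![1,0,0], ![-1,0,0], ![0,2,0], b]
  have hw : ∀ i ∈ Finset.univ, 0 ≤ w i := by
    intro i _
    fin_cases i <;> refine div_nonneg ?_ hD.le <;> linarith
  have hsum : ∑ i, w i = 1 := by
    simp only [Fin.sum_univ_four, w, D, Matrix.cons_val]
    field_simp
    ring
  have hz : ∀ i ∈ Finset.univ,
      z i ∈ convexHull ℝ ({![1,0,0], ![-1,0,0], ![0,2,0], b} : Set (Fin 3 → ℝ)) := by
    intro i _
    apply subset_convexHull
    fin_cases i <;> simp [z]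
  have hq : ∑ i, w i • z i = q := by
    ext j
    fin_cases j <;>
      simp [Fin.sum_univ_four, w, z, D] <;> field_simp <;> ring
  exact hq ▸ (convex_convexHull ℝ _).sum_mem hw hsum hz

/-- A simplex over the base `conv{±e₁, 2e₂}` with integer apex of height at least `9` is
not lattice-free. -/
theorem simplex_sail_base_not_latticefree (a : Fin 3 → ℤ) (ha : 9 ≤ a 2)
    (P : Set (Fin 3 → ℝ))
    (hP : P = convexHull ℝ ({![1,0,0], ![-1,0,0], ![0,2,0],
          (fun i => (a i : ℝ))} : Set (Fin 3 → ℝ))) :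
    (interior P ∩ intPts 3).Nonempty := by
  obtain ⟨k, x, y, h₀, h₁, h₂, h₃⟩ := exists_int_point_height_one_or_two (a 0) (a 1) (a 2) ha
  refine ⟨fun i => ((![x, y, k] i : ℤ) : ℝ), ?_, fun i => ⟨_, rfl⟩⟩
  rw [hP]
  refine mem_interior_convexHull_of_facet_ineqs _ _ (by norm_cast; lia) (mod_cast h₀) ?_ ?_ ?_ <;>
    simp only [Matrix.cons_val] <;> norm_cast
end
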